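/- arXiv:2208.12749 — 2 statements merged into one kernel-verified Lean document; each statement's English description precedes it below -/
import Mathlib

section
/- The Klein sextic K₆ defined by X⁵Y + Y⁵Z + XZ⁵ = 0 is a smooth plane sextic over K; its automorphism group Aut(K₆) ⊂ PGL₃(K) equals the subgroup generated by σ = diag(1, ζ₂₁, ζ₂₁¹⁷) and τ = [Z:X:Y], has order 63, and is nonabelian (so Aut(K₆) is isomorphic to the semidirect product Z/21Z ⋊ Z/3Z with σ²¹ = τ³ = 1 and τ⁻¹στ = σ¹⁶). -/
open MvPolynomial

/-- `GL₃(K)`: the group of invertible `3 × 3` matrices over `K`. -/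
abbrev GL3 (K : Type*) [Field K] := (Matrix (Fin 3) (Fin 3) K)ˣ

/-- `PGL₃(K)`: the quotient of `GL₃(K)` by its center (the scalar matrices). -/
abbrev PGL3 (K : Type*) [Field K] := GL3 K ⧸ Subgroup.center (GL3 K)

variable {K : Type*} [Field K]

/-- The substitution `F(X,Y,Z) ↦ F(A·(X,Y,Z)ᵗ)` for a `3 × 3` matrix `A`. -/
noncomputable def matAct (A : Matrix (Fin 3) (Fin 3) K) (F : MvPolynomial (Fin 3) K) :
    MvPolynomial (Fin 3) K :=
  aeval (fun i => ∑ j, C (A i j) * X j) F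

lemma matAct_one (F : MvPolynomial (Fin 3) K) : matAct 1 F = F := by
  unfold matAct
  have h : (fun i => ∑ j, C ((1 : Matrix (Fin 3) (Fin 3) K) i j) * X j)
      = (X : Fin 3 → MvPolynomial (Fin 3) K) := by
    funext i
    rw [Finset.sum_eq_single i]
    · simp
    · intro b _ hb
      simp [Matrix.one_apply, Ne.symm hb]
    · simp
  rw [h, aeval_X_left_apply]

lemma matAct_matAct (A B : Matrix (Fin 3) (Fin 3) K) (F : MvPolynomial (Fin 3) K) :
    matAct B (matAct A F) = matAct (A * B) F := by
  unfold matAct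
  rw [← AlgHom.comp_apply, comp_aeval]
  have h : (fun i => (aeval fun i => ∑ j, C (B i j) * X j) (∑ j, C (A i j) * X j))
      = fun i => ∑ j : Fin 3, C ((A * B) i j) * (X j : MvPolynomial (Fin 3) K) := by
    funext i
    simp only [map_sum, map_mul, aeval_C, aeval_X, algebraMap_eq, Finset.mul_sum]
    rw [Finset.sum_comm]
    refine Finset.sum_congr rfl fun k _ => ?_
    rw [Matrix.mul_apply, map_sum, Finset.sum_mul]
    refine Finset.sum_congr rfl fun j _ => ?_
    rw [map_mul, mul_assoc]
  rw [h]

lemma matAct_smul (A : Matrix (Fin 3) (Fin 3) K) (c : K) (F : MvPolynomial (Fin 3) K) :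
    matAct A (c • F) = c • matAct A F :=
  map_smul (aeval fun i => ∑ j, C (A i j) * X j) c F

/-- The class of a matrix `A` in `PGL₃(K)` (junk value `1` if `A` is not invertible). -/
noncomputable def pgl (A : Matrix (Fin 3) (Fin 3) K) : PGL3 K := by
  classical
  exact if h : IsUnit A then (QuotientGroup.mk h.unit : PGL3 K) else 1

/-- `F` defines a smooth plane sextic: `F` is homogeneous of degree `6`, and `F` together with
its partial derivatives have no common zero besides the origin. -/
def IsSmoothSextic (F : MvPolynomial (Fin 3) K) : Prop :=
  F.IsHomogeneous 6 ∧
    ∀ p : Fin 3 → K, eval p F = 0 → (∀ i, eval p (pderiv i F) = 0) → p = 0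

/-- The automorphism group of the plane curve `F = 0`: the subgroup of `PGL₃(K)` consisting of
the classes of matrices `A ∈ GL₃(K)` with `F(A·(X,Y,Z)ᵗ) = λ·F(X,Y,Z)` for some `λ ∈ K×`. -/
noncomputable def planeAut (F : MvPolynomial (Fin 3) K) : Subgroup (PGL3 K) where
  carrier := {g | ∃ A : GL3 K, (QuotientGroup.mk A : PGL3 K) = g ∧
    ∃ c : K, c ≠ 0 ∧ matAct (A : Matrix (Fin 3) (Fin 3) K) F = c • F}
  one_mem' := ⟨1, rfl, 1, one_ne_zero, by rw [Units.val_one, matAct_one, one_smul]⟩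
  mul_mem' := by
    rintro g h ⟨A, rfl, c, hc, hA⟩ ⟨B, rfl, d, hd, hB⟩
    exact ⟨A * B, rfl, c * d, mul_ne_zero hc hd, by
      rw [Units.val_mul, ← matAct_matAct, hA, matAct_smul, hB, smul_smul]⟩
  inv_mem' := by
    rintro g ⟨A, rfl, c, hc, hA⟩
    refine ⟨A⁻¹, rfl, c⁻¹, inv_ne_zero hc, ?_⟩
    rw [eq_inv_smul_iff₀ hc, ← matAct_smul, ← hA, matAct_matAct, ← Units.val_mul,
      mul_inv_cancel, Units.val_one, matAct_one]

/-- The Klein sextic `X⁵Y + Y⁵Z + XZ⁵`. -/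
noncomputable def kleinSextic (K : Type*) [Field K] : MvPolynomial (Fin 3) K :=
  X 0 ^ 5 * X 1 + X 1 ^ 5 * X 2 + X 0 * X 2 ^ 5

theorem matAct_eq_smul_iff [Infinite K] (A : Matrix (Fin 3) (Fin 3) K)
    (F : MvPolynomial (Fin 3) K) (c : K) :
    matAct A F = c • F ↔ ∀ p, eval (A.mulVec p) F = c * eval p F := by
  have key : ∀ p, eval p (matAct A F) = eval (A.mulVec p) F := fun p => by
    unfold matAct
    rw [← coe_aeval_eq_eval, ← coe_aeval_eq_eval, RingHom.coe_coe, RingHom.coe_coe,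
      ← AlgHom.comp_apply, comp_aeval]
    congr 2
    funext i
    simp [Matrix.mulVec, dotProduct]
  constructor
  · intro h p
    rw [← key, h, smul_eval]
  · intro h
    refine MvPolynomial.funext fun p => ?_
    rw [key, h, smul_eval]

theorem pgl_of_isUnit {A : Matrix (Fin 3) (Fin 3) K} (h : IsUnit A) :
    pgl A = (QuotientGroup.mk h.unit : PGL3 K) := by
  unfold pgl
  rw [dif_pos h]

theorem pgl_coe (A : GL3 K) : pgl (A : Matrix (Fin 3) (Fin 3) K) = QuotientGroup.mk A := by
  rw [pgl_of_isUnit A.isUnit]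
  congr 1
  exact Units.ext rfl

theorem pgl_one : pgl (1 : Matrix (Fin 3) (Fin 3) K) = 1 :=
  pgl_coe 1

theorem pgl_mul {A B : Matrix (Fin 3) (Fin 3) K} (hA : IsUnit A) (hB : IsUnit B) :
    pgl (A * B) = pgl A * pgl B := by
  obtain ⟨A, rfl⟩ := hA
  obtain ⟨B, rfl⟩ := hB
  rw [← Units.val_mul, pgl_coe, pgl_coe, pgl_coe, QuotientGroup.mk_mul]

theorem pgl_pow {A : Matrix (Fin 3) (Fin 3) K} (hA : IsUnit A) (n : ℕ) :
    pgl (A ^ n) = pgl A ^ n := by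
  induction n with
  | zero => rw [pow_zero, pow_zero, pgl_one]
  | succ n ih => rw [pow_succ, pow_succ, pgl_mul (hA.pow n) hA, ih]

theorem pgl_eq_pgl_iff {A B : Matrix (Fin 3) (Fin 3) K} (hA : IsUnit A) (hB : IsUnit B) :
    pgl A = pgl B ↔ ∃ c : K, B = c • A := by
  obtain ⟨A, rfl⟩ := hA
  obtain ⟨B, rfl⟩ := hB
  rw [pgl_coe, pgl_coe, QuotientGroup.eq]
  have hc := Matrix.GeneralLinearGroup.mem_center_iff_val_mem_range_scalar (n := Fin 3) (R := K)
    (g := A⁻¹ * B)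
  refine Iff.trans hc ⟨?_, ?_⟩
  · rintro ⟨c, hc⟩
    refine ⟨c, ?_⟩
    calc (B : Matrix (Fin 3) (Fin 3) K) = A * ((A⁻¹ * B : GL3 K) : Matrix (Fin 3) (Fin 3) K) := by
          rw [← Units.val_mul, mul_inv_cancel_left]
      _ = c • A := by
          rw [← hc, Matrix.scalar_apply, ← Matrix.smul_one_eq_diagonal, mul_smul_comm, mul_one]
  · rintro ⟨c, hc⟩
    refine ⟨c, ?_⟩
    rw [Units.val_mul, hc, mul_smul_comm, Units.inv_mul]
    simp [Matrix.smul_one_eq_diagonal]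

theorem eval_kleinSextic (p : Fin 3 → K) :
    eval p (kleinSextic K) = p 0 ^ 5 * p 1 + p 1 ^ 5 * p 2 + p 0 * p 2 ^ 5 := by
  simp [kleinSextic]

theorem kleinSextic_isHomogeneous : (kleinSextic K).IsHomogeneous 6 := by
  have h (i : Fin 3) : (X i : MvPolynomial (Fin 3) K).IsHomogeneous 1 := isHomogeneous_X K i
  exact ((((h 0).pow 5).mul (h 1)).add (((h 1).pow 5).mul (h 2))).add ((h 0).mul ((h 2).pow 5))

theorem isSmoothSextic_kleinSextic [CharZero K] : IsSmoothSextic (kleinSextic K) := by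
  refine ⟨kleinSextic_isHomogeneous, fun p _ h => ?_⟩
  have h0 := h 0
  have h1 := h 1
  have h2 := h 2
  simp [kleinSextic, pderiv_X] at h0 h1 h2
  have hprod : (p 0 * p 1 * p 2) ^ 5 = 0 := by
    have h126 : (126 : K) * (p 0 * p 1 * p 2) ^ 5 = 0 := by
      linear_combination p 0 ^ 5 * p 1 ^ 5 * h0 - p 0 ^ 4 * 5 * p 1 ^ 6 * h1
        + 25 * p 0 ^ 4 * p 1 ^ 5 * p 2 * h2
    simpa using h126
  have hcases : (p 0 = 0 ∨ p 1 = 0) ∨ p 2 = 0 := by simpa using hprod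
  have hp : p 0 = 0 ∧ p 1 = 0 ∧ p 2 = 0 := by
    rcases hcases with (h | h) | h <;> simp_all
  funext i
  fin_cases i
  exacts [hp.1, hp.2.1, hp.2.2]

/-- The point `p` is a point of `F = 0` at which some line, parametrized by `p` and `q`, meets
the curve in the divisor consisting of `p` with multiplicity `5` and of one further point, possibly `p` again. -/
def IsHyperflex (F : MvPolynomial (Fin 3) K) (p : Fin 3 → K) : Prop :=
  ∃ q : Fin 3 → K, LinearIndependent K ![p, q] ∧
    ∃ α β : K, ∀ s t : K, eval (s • p + t • q) F = α * s * t ^ 5 + β * t ^ 6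

theorem IsHyperflex.mulVec {F : MvPolynomial (Fin 3) K} {p : Fin 3 → K} (hp : IsHyperflex F p)
    (A : GL3 K) {c : K}
    (hA : ∀ p, eval ((A : Matrix (Fin 3) (Fin 3) K).mulVec p) F = c * eval p F) :
    IsHyperflex F ((A : Matrix (Fin 3) (Fin 3) K).mulVec p) := by
  obtain ⟨q, hpq, α, β, h⟩ := hp
  refine ⟨(A : Matrix (Fin 3) (Fin 3) K).mulVec q, ?_, c * α, c * β, fun s t => ?_⟩
  · have := hpq.map' (Matrix.mulVecLin (A : Matrix (Fin 3) (Fin 3) K))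
      (LinearMap.ker_eq_bot.mpr (Matrix.mulVec_injective_of_isUnit A.isUnit))
    rwa [show (Matrix.mulVecLin (A : Matrix (Fin 3) (Fin 3) K)) ∘ ![p, q] =
      ![(A : Matrix (Fin 3) (Fin 3) K).mulVec p, (A : Matrix (Fin 3) (Fin 3) K).mulVec q] by
        funext i; fin_cases i <;> rfl] at this
  · rw [← Matrix.mulVec_smul, ← Matrix.mulVec_smul, ← Matrix.mulVec_add, hA, h]
    ring

theorem eq_zero_of_forall_sextic_eq_zero [CharZero K] {c₁ c₂ c₃ c₄ c₅ c₆ : K}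
    (h : ∀ t : K, c₁ * t + c₂ * t ^ 2 + c₃ * t ^ 3 + c₄ * t ^ 4 + c₅ * t ^ 5 + c₆ * t ^ 6 = 0) :
    c₂ = 0 ∧ c₃ = 0 ∧ c₄ = 0 := by
  have h1 := h 1
  have h2 := h (-1)
  have h3 := h 2
  have h4 := h (-2)
  have h5 := h 3
  have h6 := h (-3)
  refine ⟨?_, ?_, ?_⟩
  · linear_combination (3 / 4) * (h1 + h2) - (3 / 40) * (h3 + h4) + (1 / 180) * (h5 + h6)
  · linear_combination (-13 / 48) * (h1 - h2) + (1 / 6) * (h3 - h4) - (1 / 48) * (h5 - h6)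
  · linear_combination (-13 / 48) * (h1 + h2) + (1 / 12) * (h3 + h4) - (1 / 144) * (h5 + h6)

theorem isHyperflex_single [CharZero K] (j : Fin 3) :
    IsHyperflex (kleinSextic K) (Pi.single j 1) := by
  refine ⟨Pi.single (j + 2) 1, ?_, 1, 0, fun s t => ?_⟩
  · rw [LinearIndependent.pair_iff]
    intro s t h
    fin_cases j <;> simpa [funext_iff, Fin.forall_fin_succ, Pi.single_apply, and_comm] using h
  · rw [eval_kleinSextic]
    fin_cases j <;> simp <;> ring

theorem IsHyperflex.exists_forall_ne_eq_zero [CharZero K] {p : Fin 3 → K}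
    (hp : IsHyperflex (kleinSextic K) p) : ∃ i, ∀ j, j ≠ i → p j = 0 := by
  obtain ⟨q, hpq, α, β, h⟩ := hp
  have hp0 := h 1 0
  simp only [eval_kleinSextic, Pi.add_apply, Pi.smul_apply, smul_eq_mul] at h hp0
  rw [LinearIndependent.pair_iff] at hpq
  by_cases hx : p 0 = 0
  · have : p 1 = 0 ∨ p 2 = 0 := by simpa [hx] using hp0
    rcases this with h1 | h1
    · exact ⟨2, by simp [Fin.forall_fin_succ, *]⟩
    · exact ⟨1, by simp [Fin.forall_fin_succ, *]⟩
  by_cases hy : p 1 = 0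
  · have : p 2 = 0 := by simpa [hx, hy] using hp0
    exact ⟨0, by simp [Fin.forall_fin_succ, *]⟩
  by_cases hz : p 2 = 0
  · exact absurd hp0 (by simp [*])
  exfalso
  obtain ⟨u, hu⟩ : ∃ u, u = q 0 / p 0 - q 2 / p 2 := ⟨_, rfl⟩
  obtain ⟨v, hv⟩ : ∃ v, v = q 1 / p 1 - q 2 / p 2 := ⟨_, rfl⟩
  have hq0 : q 0 = p 0 * u + q 2 / p 2 * p 0 := by rw [hu]; field_simp; ring
  have hq1 : q 1 = p 1 * v + q 2 / p 2 * p 1 := by rw [hv]; field_simp; ring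
  have hq2 : q 2 = q 2 / p 2 * p 2 := by field_simp
  obtain ⟨w, hw⟩ : ∃ w, w = q 2 / p 2 := ⟨_, rfl⟩
  rw [← hw] at hq0 hq1 hq2
  have huv : ¬ (u = 0 ∧ v = 0) := by
    rintro ⟨rfl, rfl⟩
    refine one_ne_zero (α := K) (hpq (-w) 1 ?_).2
    funext i
    fin_cases i
    · simp [hq0]
    · simp [hq1]
    · simp
      linear_combination hq2
  obtain ⟨x, hx'⟩ : ∃ x, x = p 0 := ⟨_, rfl⟩
  obtain ⟨y, hy'⟩ : ∃ y, y = p 1 := ⟨_, rfl⟩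
  obtain ⟨z, hz'⟩ : ∃ z, z = p 2 := ⟨_, rfl⟩
  rw [hq0, hq1, hq2, ← hx', ← hy', ← hz'] at h
  rw [← hx'] at hx
  rw [← hy'] at hy
  rw [← hz'] at hz
  obtain ⟨a, ha⟩ : ∃ a, a = x ^ 5 * y := ⟨_, rfl⟩
  obtain ⟨b, hb⟩ : ∃ b, b = y ^ 5 * z := ⟨_, rfl⟩
  have ha0 : a ≠ 0 := by rw [ha]; positivity
  have hb0 : b ≠ 0 := by rw [hb]; positivity
  have hF : x ^ 5 * y + y ^ 5 * z + x * z ^ 5 = 0 := by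
    linear_combination h 1 0
  obtain ⟨h2, h3, h4⟩ := eq_zero_of_forall_sextic_eq_zero
    (c₁ := a * (5 * u + v) + 5 * b * v + x * z ^ 5 * u)
    (c₂ := a * (10 * u ^ 2 + 5 * u * v) + 10 * b * v ^ 2)
    (c₃ := a * (10 * u ^ 3 + 10 * u ^ 2 * v) + 10 * b * v ^ 3)
    (c₄ := a * (5 * u ^ 4 + 10 * u ^ 3 * v) + 5 * b * v ^ 4)
    (c₅ := a * (u ^ 5 + 5 * u ^ 4 * v) + b * v ^ 5 - α)
    (c₆ := a * u ^ 5 * v + α * w - β) (fun t => by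
      rw [ha, hb]
      linear_combination h (1 - w * t) t - hF)
  have hu0 : u ≠ 0 := by
    rintro rfl
    simp [hb0] at h2
    exact huv ⟨rfl, h2⟩
  have h23 : 2 * u ^ 2 - v ^ 2 = 0 := by
    have : a * u * (2 * u ^ 2 - v ^ 2) = 0 := by
      linear_combination (1 / 5) * h3 - v / 5 * h2
    simpa [ha0, hu0] using this
  have h24 : v ^ 2 * (v - u) = 0 := by
    have : a * u * (2 * u ^ 3 + 4 * u ^ 2 * v - 2 * u * v ^ 2 - v ^ 3) = 0 := by
      linear_combination (2 / 5) * h4 - v ^ 2 / 5 * h2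
    have := (mul_eq_zero.mp this).resolve_left (mul_ne_zero ha0 hu0)
    linear_combination this - (u + 2 * v) * h23
  rcases mul_eq_zero.mp h24 with hv | hv
  · have : u ^ 2 = 0 := by linear_combination h23 / 2 + hv / 2
    exact hu0 (pow_eq_zero_iff two_ne_zero |>.mp this)
  · rw [sub_eq_zero.mp hv] at h23
    have : u ^ 2 = 0 := by linear_combination h23
    exact hu0 (pow_eq_zero_iff two_ne_zero |>.mp this)

/-- The matrix of `σ`. -/
def sigmaMat (ζ : K) : Matrix (Fin 3) (Fin 3) K := !![1, 0, 0; 0, ζ, 0; 0, 0, ζ ^ 17]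

/-- The matrix of `τ`. -/
def tauMat (K : Type*) [Field K] : Matrix (Fin 3) (Fin 3) K := !![0, 0, 1; 1, 0, 0; 0, 1, 0]

theorem sigmaMat_pow (ζ : K) (n : ℕ) : sigmaMat ζ ^ n = sigmaMat (ζ ^ n) := by
  have (ζ : K) : sigmaMat ζ = Matrix.diagonal ![1, ζ, ζ ^ 17] := by
    ext i j
    fin_cases i <;> fin_cases j <;> simp [sigmaMat]
  rw [this, this, Matrix.diagonal_pow]
  congr 1
  funext i
  fin_cases i <;> simp [← pow_mul, mul_comm]

theorem tauMat_sq : tauMat K ^ 2 = !![0, 1, 0; 0, 0, 1; 1, 0, 0] := by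
  simp [tauMat, pow_two]

theorem tauMat_pow_three : tauMat K ^ 3 = 1 := by
  rw [pow_succ, tauMat_sq, Matrix.one_fin_three]
  simp [tauMat]

theorem isUnit_tauMat : IsUnit (tauMat K) :=
  IsUnit.of_pow_eq_one tauMat_pow_three three_ne_zero

theorem isUnit_sigmaMat {ζ : K} (hζ : ζ ≠ 0) : IsUnit (sigmaMat ζ) := by
  rw [Matrix.isUnit_iff_isUnit_det, isUnit_iff_ne_zero, sigmaMat, Matrix.det_fin_three]
  simp [hζ]

theorem pgl_mem_planeAut [Infinite K] {A : Matrix (Fin 3) (Fin 3) K} (hA : IsUnit A)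
    {F : MvPolynomial (Fin 3) K} {c : K} (hc : c ≠ 0)
    (h : ∀ p, eval (A.mulVec p) F = c * eval p F) : pgl A ∈ planeAut F := by
  obtain ⟨A, rfl⟩ := hA
  exact ⟨A, (pgl_coe A).symm, c, hc, (matAct_eq_smul_iff _ _ _).mpr h⟩

theorem pgl_tauMat_mem [Infinite K] : pgl (tauMat K) ∈ planeAut (kleinSextic K) :=
  pgl_mem_planeAut isUnit_tauMat one_ne_zero fun p => by
    rw [eval_kleinSextic, eval_kleinSextic]
    simp [tauMat, Matrix.mulVec, dotProduct, Fin.sum_univ_three]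
    ring

theorem pgl_sigmaMat_mem [Infinite K] {ζ : K} (hζ : ζ ^ 21 = 1) :
    pgl (sigmaMat ζ) ∈ planeAut (kleinSextic K) := by
  have h0 : ζ ≠ 0 := by
    rintro rfl
    simp at hζ
  refine pgl_mem_planeAut (isUnit_sigmaMat h0) h0 fun p => ?_
  rw [eval_kleinSextic, eval_kleinSextic]
  simp [sigmaMat, Matrix.mulVec, dotProduct, Fin.sum_univ_three]
  linear_combination (p 1 ^ 5 * p 2 * ζ + p 0 * p 2 ^ 5 * ζ * (ζ ^ 63 + ζ ^ 42 + ζ ^ 21 + 1)) * hζ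

theorem exists_pgl_eq_of_diagonal {ζ : K} (hζ : IsPrimitiveRoot ζ 21)
    {A : Matrix (Fin 3) (Fin 3) K} (hA : IsUnit A) {a b d c : K}
    (hA' : A = !![a, 0, 0; 0, b, 0; 0, 0, d]) (hc : c ≠ 0)
    (h1 : a ^ 5 * b = c) (h2 : b ^ 5 * d = c) (h3 : a * d ^ 5 = c) :
    ∃ j : Fin 21, pgl A = pgl (sigmaMat ζ) ^ (j : ℕ) := by
  have ha : a ≠ 0 := by rintro rfl; simp_all
  have hb : b ≠ 0 := by rintro rfl; simp_all
  have hd : d ≠ 0 := by rintro rfl; simp_all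
  have hB : b / a = (d / a) ^ 5 := by
    field_simp
    refine mul_left_cancel₀ ha ?_
    linear_combination h1 - h3
  have hD : (d / a) ^ 21 = 1 := by
    have : (b / a) ^ 4 * (d / a) = 1 := by
      field_simp
      refine mul_left_cancel₀ hb ?_
      linear_combination h2 - h1
    rw [hB] at this
    rw [← this]
    ring
  obtain ⟨k, hk, hk'⟩ := hζ.eq_pow_of_pow_eq_one hD
  refine ⟨⟨(5 * k) % 21, Nat.mod_lt _ (by norm_num)⟩, ?_⟩
  have h0 : ζ ≠ 0 := hζ.ne_zero (by norm_num)
  rw [← pgl_pow (isUnit_sigmaMat h0), sigmaMat_pow,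
    pgl_eq_pgl_iff hA (isUnit_sigmaMat (pow_ne_zero _ h0))]
  have e : ζ ^ ((5 * k) % 21) = (ζ ^ k) ^ 5 := by
    rw [hζ.eq_orderOf, pow_mod_orderOf, pow_mul, pow_right_comm]
  refine ⟨a⁻¹, ?_⟩
  have e2 : ((ζ ^ k) ^ 5) ^ 17 = ζ ^ k := by
    rw [hk']
    linear_combination (d / a) * ((d / a) ^ 63 + (d / a) ^ 42 + (d / a) ^ 21 + 1) * hD
  simp only [hA', sigmaMat, e, e2]
  rw [hk', ← hB]
  ext i j
  fin_cases i <;> fin_cases j <;> simp [ha] <;> field_simp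

theorem apply_single_of_planeAut [CharZero K] {A : GL3 K} {c : K}
    (hA : ∀ p, eval ((A : Matrix (Fin 3) (Fin 3) K).mulVec p) (kleinSextic K)
      = c * eval p (kleinSextic K)) (j : Fin 3) :
    ∃ i, ∀ k, k ≠ i → (A : Matrix (Fin 3) (Fin 3) K) k j = 0 := by
  obtain ⟨i, hi⟩ := ((isHyperflex_single j).mulVec A hA).exists_forall_ne_eq_zero
  exact ⟨i, fun k hk => by simpa using hi k hk⟩

theorem exists_pgl_eq_of_apply_zero [CharZero K] {ζ : K} (hζ : IsPrimitiveRoot ζ 21) {A : GL3 K}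
    {c : K} (hc : c ≠ 0)
    (hA : ∀ p, eval ((A : Matrix (Fin 3) (Fin 3) K).mulVec p) (kleinSextic K)
      = c * eval p (kleinSextic K)) (h0 : ∀ k, k ≠ 0 → (A : Matrix (Fin 3) (Fin 3) K) k 0 = 0) :
    ∃ j : Fin 21, (QuotientGroup.mk A : PGL3 K) = pgl (sigmaMat ζ) ^ (j : ℕ) := by
  rw [← pgl_coe]
  have hu := A.isUnit
  obtain ⟨i1, h1⟩ := apply_single_of_planeAut hA 1
  obtain ⟨i2, h2⟩ := apply_single_of_planeAut hA 2
  generalize (A : Matrix (Fin 3) (Fin 3) K) = M at *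
  have hdet : M.det ≠ 0 := ((Matrix.isUnit_iff_isUnit_det _).mp hu).ne_zero
  have hM10 := h0 1 (by decide)
  have hM20 := h0 2 (by decide)
  rw [Matrix.det_fin_three] at hdet
  have hx := hA ![1, 1, 0]
  have hx' := hA ![1, 2, 0]
  have hy := hA ![0, 1, 1]
  have hz := hA ![1, 0, 1]
  simp only [eval_kleinSextic, Matrix.mulVec, dotProduct, Fin.sum_univ_three, hM10, hM20] at *
  simp only [Matrix.cons_val] at hx hx' hy hz
  obtain rfl : i1 = 1 := by
    fin_cases i1
    · simp [h1] at hdet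
    · rfl
    · simp [h1] at hx hx'
      have : c = 0 := by linear_combination (1 / 30) * hx' - (16 / 15) * hx
      exact absurd this hc
  obtain rfl : i2 = 2 := by
    fin_cases i2
    · simp [h1, h2] at hdet
    · simp [h1, h2] at hdet
    · rfl
  have hM01 := h1 0 (by decide)
  have hM21 := h1 2 (by decide)
  have hM02 := h2 0 (by decide)
  have hM12 := h2 1 (by decide)
  refine exists_pgl_eq_of_diagonal hζ hu (a := M 0 0) (b := M 1 1) (d := M 2 2) ?_ hc ?_ ?_ ?_
  · ext i j
    fin_cases i <;> fin_cases j <;> simp [*]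
  · simpa [*] using hx
  · simpa [*] using hy
  · simpa [*] using hz

theorem eval_tauMat_pow_mulVec (n : ℕ) (p : Fin 3 → K) :
    eval ((tauMat K ^ n).mulVec p) (kleinSextic K) = eval p (kleinSextic K) := by
  induction n with
  | zero => simp
  | succ n ih =>
    rw [pow_succ', ← Matrix.mulVec_mulVec, ← ih, eval_kleinSextic, eval_kleinSextic]
    generalize (tauMat K ^ n).mulVec p = q
    simp [tauMat, Matrix.mulVec, dotProduct, Fin.sum_univ_three]
    ring

theorem exists_eq_of_mem_planeAut [CharZero K] {ζ : K} (hζ : IsPrimitiveRoot ζ 21) {g : PGL3 K}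
    (hg : g ∈ planeAut (kleinSextic K)) :
    ∃ x : Fin 3 × Fin 21, g = pgl (tauMat K) ^ (x.1 : ℕ) * pgl (sigmaMat ζ) ^ (x.2 : ℕ) := by
  obtain ⟨A, rfl, c, hc, hA⟩ := hg
  rw [matAct_eq_smul_iff] at hA
  obtain ⟨i, hi⟩ := apply_single_of_planeAut hA 0
  obtain ⟨T, hT⟩ := isUnit_tauMat (K := K)
  obtain ⟨j, hj⟩ := exists_pgl_eq_of_apply_zero hζ (A := T ^ (3 - (i : ℕ)) * A) hc
    (fun p => by
      rw [Units.val_mul, ← Matrix.mulVec_mulVec, Units.val_pow_eq_pow_val, hT,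
        eval_tauMat_pow_mulVec, hA])
    (fun k hk => by
      rw [Units.val_mul, Matrix.mul_apply, Fin.sum_univ_three, Units.val_pow_eq_pow_val, hT]
      fin_cases i
      · fin_cases k <;> simp_all [tauMat_pow_three]
      · fin_cases k <;> simp_all [tauMat_sq]
      · fin_cases k <;> simp_all [tauMat])
  refine ⟨(i, j), ?_⟩
  have hT3 : T ^ (i : ℕ) * T ^ (3 - (i : ℕ)) = 1 := by
    rw [← pow_add, Nat.add_sub_of_le i.is_lt.le]
    exact Units.ext (by rw [Units.val_pow_eq_pow_val, hT, tauMat_pow_three, Units.val_one])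
  rw [← hj, ← hT, pgl_coe, ← QuotientGroup.mk_pow, ← QuotientGroup.mk_mul, ← mul_assoc, hT3,
    one_mul]

theorem injective_pgl_tauMat_pow_mul_pgl_sigmaMat_pow {ζ : K} (hζ : IsPrimitiveRoot ζ 21) :
    Function.Injective fun x : Fin 3 × Fin 21 =>
      pgl (tauMat K) ^ (x.1 : ℕ) * pgl (sigmaMat ζ) ^ (x.2 : ℕ) := by
  rintro ⟨i, j⟩ ⟨i', j'⟩ h
  have h0 (n : ℕ) : ζ ^ n ≠ 0 := pow_ne_zero n (hζ.ne_zero (by norm_num))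
  have hS := isUnit_sigmaMat (hζ.ne_zero (by norm_num))
  simp only [← pgl_pow isUnit_tauMat, ← pgl_pow hS] at h
  rw [← pgl_mul (isUnit_tauMat.pow _) (hS.pow _), ← pgl_mul (isUnit_tauMat.pow _) (hS.pow _),
    pgl_eq_pgl_iff ((isUnit_tauMat.pow _).mul (hS.pow _)) ((isUnit_tauMat.pow _).mul (hS.pow _)),
    sigmaMat_pow, sigmaMat_pow] at h
  obtain ⟨c, h⟩ := h
  obtain rfl : i = i' := by
    have h1 := congrFun (congrFun h i') 0
    fin_cases i <;> fin_cases i' <;> simp [tauMat_sq] at h1 ⊢ <;> simp [tauMat, sigmaMat] at h1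
  rw [← mul_smul_comm] at h
  have h := (isUnit_tauMat.pow _).mul_left_cancel h
  have hc : 1 = c := by simpa [sigmaMat] using congrFun (congrFun h 0) 0
  have hj : ζ ^ (j' : ℕ) = ζ ^ (j : ℕ) := by
    simpa [sigmaMat, ← hc] using congrFun (congrFun h 1) 1
  rw [Fin.ext (hζ.pow_inj j'.is_lt j.is_lt hj)]

theorem natCard_planeAut_kleinSextic [CharZero K] {ζ : K} (hζ : IsPrimitiveRoot ζ 21) :
    Nat.card (planeAut (kleinSextic K)) = 63 := by
  let f : Fin 3 × Fin 21 → planeAut (kleinSextic K) := fun x =>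
    ⟨pgl (tauMat K) ^ (x.1 : ℕ) * pgl (sigmaMat ζ) ^ (x.2 : ℕ),
      mul_mem (pow_mem pgl_tauMat_mem _) (pow_mem (pgl_sigmaMat_mem hζ.pow_eq_one) _)⟩
  have hf : Function.Bijective f := by
    refine ⟨fun x y hxy => injective_pgl_tauMat_pow_mul_pgl_sigmaMat_pow hζ
      (congrArg Subtype.val hxy), fun g => ?_⟩
    obtain ⟨x, hx⟩ := exists_eq_of_mem_planeAut hζ g.2
    exact ⟨x, Subtype.ext hx.symm⟩
  rw [← Nat.card_eq_of_bijective f hf]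
  simp

theorem planeAut_kleinSextic_eq_closure [CharZero K] {ζ : K} (hζ : IsPrimitiveRoot ζ 21) :
    planeAut (kleinSextic K) = Subgroup.closure {pgl (sigmaMat ζ), pgl (tauMat K)} := by
  apply le_antisymm
  · intro g hg
    obtain ⟨x, rfl⟩ := exists_eq_of_mem_planeAut hζ hg
    exact mul_mem (pow_mem (Subgroup.subset_closure (by simp)) _)
      (pow_mem (Subgroup.subset_closure (by simp)) _)
  · rw [Subgroup.closure_le]
    rintro g (rfl | rfl)
    exacts [pgl_sigmaMat_mem hζ.pow_eq_one, pgl_tauMat_mem]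

theorem pgl_sigmaMat_mul_pgl_tauMat {ζ : K} (hζ : ζ ^ 21 = 1) :
    pgl (sigmaMat ζ) * pgl (tauMat K) = pgl (tauMat K) * pgl (sigmaMat ζ) ^ 16 := by
  have h0 : ζ ≠ 0 := by
    rintro rfl
    simp at hζ
  have hS := isUnit_sigmaMat h0
  rw [← pgl_pow hS, ← pgl_mul hS isUnit_tauMat, ← pgl_mul isUnit_tauMat (hS.pow _),
    pgl_eq_pgl_iff (hS.mul isUnit_tauMat) (isUnit_tauMat.mul (hS.pow _)), sigmaMat_pow]
  refine ⟨ζ ^ 20, ?_⟩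
  have h1 : (ζ ^ 16) ^ 17 = ζ ^ 20 := by
    rw [← pow_mul, pow_eq_pow_mod _ hζ]
  have h2 : ζ ^ 20 * ζ ^ 17 = ζ ^ 16 := by
    rw [← pow_add, pow_eq_pow_mod _ hζ]
  have h3 : ζ ^ 20 * ζ = 1 := by
    rw [← pow_succ, hζ]
  simp [sigmaMat, tauMat, h1, h2, h3]

theorem not_commute_pgl_sigmaMat_pgl_tauMat {ζ : K} (hζ : IsPrimitiveRoot ζ 21) :
    pgl (sigmaMat ζ) * pgl (tauMat K) ≠ pgl (tauMat K) * pgl (sigmaMat ζ) := by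
  rw [pgl_sigmaMat_mul_pgl_tauMat hζ.pow_eq_one]
  intro h
  have := @injective_pgl_tauMat_pow_mul_pgl_sigmaMat_pow K _ ζ hζ (1, 16) (1, 1)
    (by simpa using h)
  simp at this

/-- The Klein sextic is smooth; its automorphism group is generated by
`σ = diag(1, ζ₂₁, ζ₂₁¹⁷)` and `τ = [Z:X:Y]`, has order `63`, is nonabelian, and
`σ²¹ = τ³ = 1`, `τ⁻¹στ = σ¹⁶`. -/
theorem klein_sextic_automorphisms {K : Type*} [Field K] [IsAlgClosed K] [CharZero K]
    (ζ : K) (hζ : IsPrimitiveRoot ζ 21) :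
    IsSmoothSextic (kleinSextic K) ∧
    planeAut (kleinSextic K) = Subgroup.closure
      {pgl !![1, 0, 0; 0, ζ, 0; 0, 0, ζ ^ 17], pgl !![(0 : K), 0, 1; 1, 0, 0; 0, 1, 0]} ∧
    Nat.card ↥(planeAut (kleinSextic K)) = 63 ∧
    (∃ g h : PGL3 K, g ∈ planeAut (kleinSextic K) ∧ h ∈ planeAut (kleinSextic K) ∧
      g * h ≠ h * g) ∧
    (pgl !![1, 0, 0; 0, ζ, 0; 0, 0, ζ ^ 17]) ^ 21 = 1 ∧
    (pgl !![(0 : K), 0, 1; 1, 0, 0; 0, 1, 0]) ^ 3 = 1 ∧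
    (pgl !![(0 : K), 0, 1; 1, 0, 0; 0, 1, 0])⁻¹ * pgl !![1, 0, 0; 0, ζ, 0; 0, 0, ζ ^ 17] *
        pgl !![(0 : K), 0, 1; 1, 0, 0; 0, 1, 0]
      = (pgl !![1, 0, 0; 0, ζ, 0; 0, 0, ζ ^ 17]) ^ 16 := by
  have hτ3 : pgl (tauMat K) ^ 3 = 1 := by
    rw [← pgl_pow isUnit_tauMat, tauMat_pow_three, pgl_one]
  have hσ21 : pgl (sigmaMat ζ) ^ 21 = 1 := by
    rw [← pgl_pow (isUnit_sigmaMat (hζ.ne_zero (by norm_num))), sigmaMat_pow, hζ.pow_eq_one,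
      sigmaMat, one_pow, ← Matrix.one_fin_three, pgl_one]
  exact ⟨isSmoothSextic_kleinSextic, planeAut_kleinSextic_eq_closure hζ,
    natCard_planeAut_kleinSextic hζ,
    ⟨pgl (sigmaMat ζ), pgl (tauMat K), pgl_sigmaMat_mem hζ.pow_eq_one, pgl_tauMat_mem,
      not_commute_pgl_sigmaMat_pgl_tauMat hζ⟩,
    hσ21, hτ3,
    by
      rw [mul_assoc, inv_mul_eq_iff_eq_mul]
      exact pgl_sigmaMat_mul_pgl_tauMat hζ.pow_eq_one⟩
end

section
/- The plane sextic C defined by X⁶ + Y⁵Z + YZ⁵ = 0 is smooth over K, its automorphism group Aut(C) ⊂ PGL₃(K) has order 144 and is isomorphic to the direct product Z/3Z × GL₂(F₃) (where GL₂(F₃) is the group of invertible 2×2 matrices over the field with 3 elements); it is generated by diag(1, ζ₂₄, ζ₂₄¹⁹), [X:Z:Y], and [X : c(ζ₈⁵Z − Y) : ζ₈·c(ζ₈Z − Y)] where c = (1 + ζ₄)/2. -/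
open MvPolynomial

variable {K : Type*} [Field K]

/-- The plane sextic form `X⁶ + Y⁵Z + YZ⁵`. -/
noncomputable abbrev octahedralSextic (K : Type*) [Field K] : MvPolynomial (Fin 3) K :=
  X 0 ^ 6 + X 1 ^ 5 * X 2 + X 1 * X 2 ^ 5

lemma isHomogeneous_octahedralSextic : (octahedralSextic K).IsHomogeneous 6 := by
  refine ((?_ : IsHomogeneous _ 6).add ?_).add ?_
  · simpa using (isHomogeneous_X K (0 : Fin 3)).pow 6
  · simpa using ((isHomogeneous_X K (1 : Fin 3)).pow 5).mul (isHomogeneous_X K (2 : Fin 3))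
  · simpa using (isHomogeneous_X K (1 : Fin 3)).mul ((isHomogeneous_X K (2 : Fin 3)).pow 5)

lemma isSmoothSextic_octahedralSextic [CharZero K] : IsSmoothSextic (octahedralSextic K) := by
  refine ⟨isHomogeneous_octahedralSextic, fun p _ hp => ?_⟩
  have h0 := hp 0
  have h1 := hp 1
  have h2 := hp 2
  simp [pderiv_X, Derivation.leibniz, Derivation.leibniz_pow] at h0 h1 h2
  have hy : p 1 = 0 := by
    have : 24 * p 1 ^ 9 = 0 := by
      linear_combination 24 * p 1 ^ 4 * h2 - 5 * (5 * p 1 * p 2 ^ 3 * h1 - p 2 ^ 4 * h2)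
    simpa using this
  have hz : p 2 = 0 := by simpa [hy] using h1
  funext i
  fin_cases i <;> simp [h0, hy, hz]

lemma eval_matAct (A : Matrix (Fin 3) (Fin 3) K) (F : MvPolynomial (Fin 3) K) (p : Fin 3 → K) :
    eval p (matAct A F) = eval (A.mulVec p) F := by
  unfold matAct
  rw [← coe_aeval_eq_eval, ← coe_aeval_eq_eval]
  simp only [RingHom.coe_coe]
  rw [← AlgHom.comp_apply, comp_aeval]
  congr 2
  funext i
  simp [Matrix.mulVec, dotProduct]

/-- The second polar of the sextic with respect to two columns of `A`, evaluated at `A w`. -/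
lemma eval_pderiv_pderiv_matAct (A : Matrix (Fin 3) (Fin 3) K) (i j : Fin 3) (w : Fin 3 → K) :
    eval w (pderiv j (pderiv i (matAct A (octahedralSextic K)))) =
      30 * A 0 i * A 0 j * A.mulVec w 0 ^ 4
      + 20 * A 1 i * A 1 j * A.mulVec w 1 ^ 3 * A.mulVec w 2
      + 5 * (A 1 i * A 2 j + A 2 i * A 1 j) * (A.mulVec w 1 ^ 4 + A.mulVec w 2 ^ 4)
      + 20 * A 2 i * A 2 j * A.mulVec w 1 * A.mulVec w 2 ^ 3 := by
  obtain ⟨l, hl⟩ : ∃ l : Fin 3 → MvPolynomial (Fin 3) K, l = fun r => ∑ s, C (A r s) * X s :=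
    ⟨_, rfl⟩
  have hd : ∀ r k : Fin 3, pderiv k (l r) = C (A r k) := by
    intro r k
    simp [hl, pderiv_X, Pi.single_apply, Derivation.leibniz]
  have he : ∀ r : Fin 3, eval w (l r) = A.mulVec w r := by
    intro r
    simp [hl, Matrix.mulVec, dotProduct]
  have hF : matAct A (octahedralSextic K) = l 0 ^ 6 + l 1 ^ 5 * l 2 + l 1 * l 2 ^ 5 := by
    simp only [matAct, map_add, map_mul, map_pow, aeval_X, hl]
  rw [hF]
  simp only [Derivation.leibniz, Derivation.leibniz_pow, map_add, hd, smul_eq_mul,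
    pderiv_C, map_mul, map_pow, eval_C, he, nsmul_eq_mul, Derivation.map_natCast, map_natCast,
    map_zero]
  push_cast
  ring

lemma polar_eq_zero [CharZero K] {A B : Matrix (Fin 3) (Fin 3) K} (hAB : A * B = 1) {c : K}
    (h : matAct A (octahedralSextic K) = c • octahedralSextic K) {j : Fin 3} (hj : j ≠ 0) :
    A 0 0 * A 0 j = 0 ∧ (A 1 0 = 0 ∧ A 2 0 = 0 ∨ A 1 j = 0 ∧ A 2 j = 0) := by
  have key : ∀ v : Fin 3 → K, 30 * A 0 0 * A 0 j * v 0 ^ 4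
      + 20 * A 1 0 * A 1 j * v 1 ^ 3 * v 2
      + 5 * (A 1 0 * A 2 j + A 2 0 * A 1 j) * (v 1 ^ 4 + v 2 ^ 4)
      + 20 * A 2 0 * A 2 j * v 1 * v 2 ^ 3 = 0 := by
    intro v
    have h1 := eval_pderiv_pderiv_matAct A 0 j (B.mulVec v)
    rw [Matrix.mulVec_mulVec, hAB, Matrix.one_mulVec, h] at h1
    have h6 : pderiv j (6 : MvPolynomial (Fin 3) K) = 0 := by
      exact_mod_cast (pderiv j).map_natCast 6
    rw [← h1]
    simp [h6, Derivation.leibniz, Derivation.leibniz_pow, pderiv_X, hj.symm]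
  have k1 := key ![1, 0, 0]
  have k2 := key ![0, 1, 0]
  have k3 := key ![0, 1, 1]
  have k4 := key ![0, 1, 2]
  simp at k1 k2 k3 k4
  refine ⟨by simpa using k1, ?_⟩
  have e1 : A 1 0 * A 1 j = 0 := by
    have : 120 * (A 1 0 * A 1 j) = 0 := by linear_combination 8 * k3 - k4 + 5 * k2
    simpa using this
  have e2 : A 2 0 * A 2 j = 0 := by
    have : 120 * (A 2 0 * A 2 j) = 0 := by linear_combination k4 - 2 * k3 - 65 * k2
    simpa using this
  grind

/-- A matrix preserving the sextic up to scalars is block diagonal. -/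
lemma block_diagonal_of_matAct_eq [CharZero K] {A B : Matrix (Fin 3) (Fin 3) K}
    (hAB : A * B = 1) {c : K}
    (h : matAct A (octahedralSextic K) = c • octahedralSextic K) :
    A 0 0 ≠ 0 ∧ A 0 1 = 0 ∧ A 0 2 = 0 ∧ A 1 0 = 0 ∧ A 2 0 = 0 := by
  obtain ⟨h1, h2⟩ := polar_eq_zero hAB h (j := 1) (by decide)
  obtain ⟨h3, h4⟩ := polar_eq_zero hAB h (j := 2) (by decide)
  have hdet : A.det ≠ 0 := fun h0 => by simpa [h0] using congrArg Matrix.det hAB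
  rw [Matrix.det_fin_three] at hdet
  grind

/-- The binary form `Y⁵Z + YZ⁵`. -/
def octahedralForm (v : Fin 2 → K) : K :=
  v 0 ^ 5 * v 1 + v 0 * v 1 ^ 5

/-- The stabilizer in `GL₂(K)` of the binary form `Y⁵Z + YZ⁵`. -/
def binaryStabilizer (K : Type*) [Field K] : Subgroup (GL (Fin 2) K) where
  carrier := {B | ∀ v : Fin 2 → K,
    octahedralForm ((B : Matrix (Fin 2) (Fin 2) K).mulVec v) = octahedralForm v}
  one_mem' := fun v => by rw [Units.val_one, Matrix.one_mulVec]
  mul_mem' := by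
    intro A B hA hB v
    rw [Units.val_mul, ← Matrix.mulVec_mulVec, hA, hB]
  inv_mem' := by
    intro B hB v
    rw [← hB, Matrix.mulVec_mulVec, Units.mul_inv, Matrix.one_mulVec]

lemma mem_binaryStabilizer {B : GL (Fin 2) K} : B ∈ binaryStabilizer K ↔ ∀ y z : K,
    (B 0 0 * y + B 0 1 * z) ^ 5 * (B 1 0 * y + B 1 1 * z)
      + (B 0 0 * y + B 0 1 * z) * (B 1 0 * y + B 1 1 * z) ^ 5 = y ^ 5 * z + y * z ^ 5 := by
  refine ⟨fun h y z => ?_, fun h v => ?_⟩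
  · simpa [octahedralForm, Matrix.mulVec, dotProduct] using h ![y, z]
  · simpa [octahedralForm, Matrix.mulVec, dotProduct] using h (v 0) (v 1)

/-- The embedding of `GL₂(K)` into `GL₃(K)` as the lower right block. -/
def lowerBlock (K : Type*) [Field K] : GL (Fin 2) K →* GL3 K :=
  Units.map
    { toFun := fun M => !![1, 0, 0; 0, M 0 0, M 0 1; 0, M 1 0, M 1 1]
      map_one' := by
        ext i j
        fin_cases i <;> fin_cases j <;> simp
      map_mul' := fun M N => by
        ext i j
        fin_cases i <;> fin_cases j <;> simp [Matrix.mul_apply, Fin.sum_univ_succ] }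

lemma lowerBlock_val (B : GL (Fin 2) K) : (lowerBlock K B : Matrix (Fin 3) (Fin 3) K) =
    !![1, 0, 0; 0, B 0 0, B 0 1; 0, B 1 0, B 1 1] :=
  rfl

/-- The embedding of `GL₂(K)` into `PGL₃(K)` as the lower right block. -/
def lowerBlockPGL (K : Type*) [Field K] : GL (Fin 2) K →* PGL3 K :=
  (QuotientGroup.mk' (Subgroup.center (GL3 K))).comp (lowerBlock K)

lemma lowerBlockPGL_injective : Function.Injective (lowerBlockPGL K) := by
  rw [injective_iff_map_eq_one]
  intro B hB
  have h : lowerBlock K B ∈ Subgroup.center (GL3 K) := (QuotientGroup.eq_one_iff _).1 hB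
  rw [Matrix.GeneralLinearGroup.mem_center_iff_val_mem_range_scalar] at h
  obtain ⟨a, ha⟩ := h
  rw [lowerBlock_val] at ha
  have e (i j : Fin 3) := congrFun (congrFun ha i) j
  have e00 := e 0 0
  have e11 := e 1 1
  have e12 := e 1 2
  have e21 := e 2 1
  have e22 := e 2 2
  simp at e00 e11 e12 e21 e22
  ext i j
  fin_cases i <;> fin_cases j <;> simp [← e11, ← e12, ← e21, ← e22, e00]

lemma pgl_eq_lowerBlockPGL (B : GL (Fin 2) K) {M : Matrix (Fin 3) (Fin 3) K}
    (h : M = !![1, 0, 0; 0, B 0 0, B 0 1; 0, B 1 0, B 1 1]) : pgl M = lowerBlockPGL K B := by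
  have hM : IsUnit M := ⟨lowerBlock K B, by rw [lowerBlock_val, h]⟩
  rw [pgl, dif_pos hM]
  change QuotientGroup.mk _ = QuotientGroup.mk _
  congr 1
  ext1
  rw [lowerBlock_val, ← h, IsUnit.unit_spec]

lemma planeAut_octahedralSextic [CharZero K] :
    planeAut (octahedralSextic K) = (binaryStabilizer K).map (lowerBlockPGL K) := by
  apply le_antisymm
  · rintro _ ⟨A, rfl, c, hc, hA⟩
    obtain ⟨h00, h01, h02, h10, h20⟩ := block_diagonal_of_matAct_eq A.mul_inv hA
    have hev (p : Fin 3 → K) := congrArg (eval p) hA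
    simp only [eval_matAct] at hev
    have hc6 : A 0 0 ^ 6 = c := by
      simpa [Matrix.mulVec, dotProduct, Fin.sum_univ_succ, h10, h20] using hev ![1, 0, 0]
    have hdet : (A : Matrix (Fin 3) (Fin 3) K).det ≠ 0 :=
      ((Matrix.isUnit_iff_isUnit_det _).1 A.isUnit).ne_zero
    rw [Matrix.det_fin_three] at hdet
    obtain ⟨B, hB⟩ : ∃ B : GL (Fin 2) K, (B : Matrix (Fin 2) (Fin 2) K) =
        !![A 1 1 / A 0 0, A 1 2 / A 0 0; A 2 1 / A 0 0, A 2 2 / A 0 0] :=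
      ⟨Matrix.GeneralLinearGroup.mkOfDetNeZero _ (by
        rw [Matrix.det_fin_two_of]
        simp only [h01, h02, h10, h20] at hdet
        intro h
        field_simp at h
        apply hdet
        linear_combination A 0 0 * h), rfl⟩
    refine ⟨B, ?_, ?_⟩
    · refine mem_binaryStabilizer.2 fun y z => ?_
      have h := hev ![0, y, z]
      simp [Matrix.mulVec, dotProduct, Fin.sum_univ_succ, h01, h02, ← hc6] at h
      simp only [hB, Matrix.of_apply, Matrix.cons_val', Matrix.cons_val_zero, Matrix.cons_val_one,
        Matrix.cons_val_fin_one]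
      field_simp
      linear_combination h
    · refine QuotientGroup.eq.2 ?_
      rw [Matrix.GeneralLinearGroup.mem_center_iff_val_mem_range_scalar]
      refine ⟨A 0 0, ?_⟩
      have h : (lowerBlock K B : Matrix (Fin 3) (Fin 3) K) * Matrix.scalar (Fin 3) (A 0 0) = A := by
        rw [lowerBlock_val]
        ext i j
        fin_cases i <;> fin_cases j <;>
          simp [hB, h00, h01, h02, h10, h20]
      rw [Units.val_mul, Units.eq_inv_mul_iff_mul_eq]
      exact h
  · rintro _ ⟨B, hB, rfl⟩
    refine ⟨lowerBlock K B, rfl, 1, one_ne_zero, ?_⟩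
    rw [one_smul]
    refine MvPolynomial.funext fun p => ?_
    rw [eval_matAct, lowerBlock_val]
    have h := mem_binaryStabilizer.1 hB (p 1) (p 2)
    simp [dotProduct, Fin.sum_univ_succ]
    linear_combination h

lemma diag_pow_val {ζ : K} {D : GL (Fin 2) K}
    (hD : (D : Matrix (Fin 2) (Fin 2) K) = !![ζ, 0; 0, ζ ^ 19]) (k : ℕ) :
    ((D ^ k : GL (Fin 2) K) : Matrix (Fin 2) (Fin 2) K) = !![ζ ^ k, 0; 0, ζ ^ (19 * k)] := by
  induction k with
  | zero => simp [Matrix.one_fin_two]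
  | succ k ih =>
    rw [pow_succ, Units.val_mul, ih, hD, Matrix.mul_fin_two]
    simp [← pow_succ, ← pow_add, mul_add]

lemma eq_diag_pow_of_mem_binaryStabilizer [CharZero K] {ζ : K} (hζ : IsPrimitiveRoot ζ 24)
    {D : GL (Fin 2) K} (hD : (D : Matrix (Fin 2) (Fin 2) K) = !![ζ, 0; 0, ζ ^ 19])
    {B : GL (Fin 2) K} (hB : B ∈ binaryStabilizer K) (h10 : B 1 0 = 0) :
    ∃ k : Fin 24, B = D ^ (k : ℕ) := by
  rw [mem_binaryStabilizer, h10] at hB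
  have hdet : (B : Matrix (Fin 2) (Fin 2) K).det ≠ 0 :=
    Matrix.GeneralLinearGroup.det_ne_zero B
  rw [Matrix.det_fin_two, h10, mul_zero, sub_zero] at hdet
  have h0 : B 0 0 ≠ 0 := left_ne_zero_of_mul hdet
  have h1 : B 1 1 ≠ 0 := right_ne_zero_of_mul hdet
  obtain ⟨p, hp00⟩ : ∃ p, B 0 0 = p := ⟨_, rfl⟩
  rw [hp00] at hB h0 hdet
  have h01 : B 0 1 = 0 := by
    have : 120 * (p ^ 4 * B 0 1 * B 1 1) = 0 := by
      linear_combination hB 2 1 + hB (-2) 1 - 4 * (hB 1 1 + hB (-1) 1) + 6 * hB 0 1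
    simpa [h0, h1] using this
  rw [h01] at hB
  have e1 := hB 1 1
  have e2 := hB 2 1
  have hp5 : p ^ 5 * B 1 1 = 1 := by
    have : 30 * (p ^ 5 * B 1 1 - 1) = 0 := by linear_combination e2 - 2 * e1
    simpa [sub_eq_zero] using this
  have hs5 : p * B 1 1 ^ 5 = 1 := by linear_combination e1 - hp5
  have hp : p ^ 24 = 1 := by
    calc p ^ 24 = p ^ 24 * (p * B 1 1 ^ 5) := by rw [hs5, mul_one]
      _ = (p ^ 5 * B 1 1) ^ 5 := by ring
      _ = 1 := by rw [hp5, one_pow]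
  have hs : B 1 1 = p ^ 19 := by linear_combination p ^ 19 * hp5 - B 1 1 * hp
  obtain ⟨k, hk, hkp⟩ := hζ.eq_pow_of_pow_eq_one hp
  refine ⟨⟨k, hk⟩, Units.ext ?_⟩
  rw [diag_pow_val hD]
  ext i j
  fin_cases i <;> fin_cases j <;> simp [hp00, h01, h10, hs, ← hkp, ← pow_mul, mul_comm]

lemma inv_mul_apply_one_zero {A B : GL (Fin 2) K} (h : A 0 0 * B 1 0 = A 1 0 * B 0 0) :
    ((A⁻¹ * B : GL (Fin 2) K) : Matrix (Fin 2) (Fin 2) K) 1 0 = 0 := by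
  have hdet := Matrix.GeneralLinearGroup.det_ne_zero A
  have e (i j : Fin 2) : (A * (A⁻¹ * B) : GL (Fin 2) K) i j = B i j := by
    rw [mul_inv_cancel_left]
  have e0 := e 0 0
  have e1 := e 1 0
  rw [Units.val_mul, Matrix.mul_apply, Fin.sum_univ_two] at e0 e1
  rw [Matrix.det_fin_two] at hdet
  have : (A 0 0 * A 1 1 - A 0 1 * A 1 0) *
      ((A⁻¹ * B : GL (Fin 2) K) : Matrix (Fin 2) (Fin 2) K) 1 0 = 0 := by
    linear_combination A 0 0 * e1 - A 1 0 * e0 + h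
  exact (mul_eq_zero.1 this).resolve_left hdet

/-- The binary octahedral stabilizer is covered by six left cosets of a cyclic group of
order `24`. -/
lemma exists_coset_of_mem_binaryStabilizer [CharZero K] {ζ c : K} (hζ : IsPrimitiveRoot ζ 24)
    {D W T : GL (Fin 2) K} (hD : (D : Matrix (Fin 2) (Fin 2) K) = !![ζ, 0; 0, ζ ^ 19])
    (hW : (W : Matrix (Fin 2) (Fin 2) K) = !![0, 1; 1, 0])
    (hT0 : T 0 0 = -c) (hT1 : T 1 0 = -(ζ ^ 3 * c))
    (hDs : D ∈ binaryStabilizer K) (hWs : W ∈ binaryStabilizer K)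
    (hTs : T ∈ binaryStabilizer K) {B : GL (Fin 2) K} (hB : B ∈ binaryStabilizer K) :
    ∃ (i : Fin 6) (k : Fin 24),
      B = (![1, W, T, D * T, D ^ 2 * T, D ^ 3 * T] : Fin 6 → GL (Fin 2) K) i * D ^ (k : ℕ) := by
  suffices h : ∃ i : Fin 6,
      (![1, W, T, D * T, D ^ 2 * T, D ^ 3 * T] : Fin 6 → GL (Fin 2) K) i 0 0 * B 1 0
      = (![1, W, T, D * T, D ^ 2 * T, D ^ 3 * T] : Fin 6 → GL (Fin 2) K) i 1 0 * B 0 0 by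
    obtain ⟨i, hi⟩ := h
    have hmem : (![1, W, T, D * T, D ^ 2 * T, D ^ 3 * T] : Fin 6 → GL (Fin 2) K) i
        ∈ binaryStabilizer K := by
      fin_cases i <;> simp [one_mem, mul_mem, pow_mem, hDs, hWs, hTs]
    obtain ⟨k, hk⟩ := eq_diag_pow_of_mem_binaryStabilizer hζ hD
      (mul_mem (inv_mem hmem) hB) (inv_mul_apply_one_zero hi)
    exact ⟨i, k, by rw [← hk, mul_inv_cancel_left]⟩
  have hroot := mem_binaryStabilizer.1 hB 1 0
  simp only [mul_one, mul_zero, add_zero] at hroot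
  by_cases hr : B 1 0 = 0
  · exact ⟨0, by simp [hr]⟩
  by_cases hp : B 0 0 = 0
  · exact ⟨1, by simp [hp, hW]⟩
  have hζ0 : ζ ≠ 0 := hζ.ne_zero (by norm_num)
  have h12 : ζ ^ 12 = -1 :=
    (hζ.pow (by norm_num) (by norm_num : 24 = 12 * 2)).eq_neg_one_of_two_right
  have h24 : ζ ^ 24 = 1 := hζ.pow_eq_one
  have h4 : IsPrimitiveRoot (ζ ^ 18) 4 := by
    have := (hζ.pow (by norm_num) (by norm_num : 24 = 6 * 4)).pow_of_coprime 3 (by norm_num)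
    rwa [← pow_mul] at this
  have hu : (B 1 0 / (ζ ^ 3 * B 0 0)) ^ 4 = 1 := by
    have : B 0 0 ^ 4 + B 1 0 ^ 4 = 0 := by
      apply (mul_eq_zero.1 (_ : (B 0 0 * B 1 0) * (B 0 0 ^ 4 + B 1 0 ^ 4) = 0)).resolve_left
      · exact mul_ne_zero hp hr
      · linear_combination hroot
    rw [div_pow, div_eq_one_iff_eq (by positivity)]
    linear_combination this - B 0 0 ^ 4 * h12
  obtain ⟨k, hk, hku⟩ := h4.eq_pow_of_pow_eq_one hu
  rw [eq_div_iff (by positivity)] at hku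
  have hDT0 : ((D ^ k * T : GL (Fin 2) K) : Matrix (Fin 2) (Fin 2) K) 0 0 = - ζ ^ k * c := by
    rw [Units.val_mul, diag_pow_val hD, Matrix.mul_apply, Fin.sum_univ_two]
    simp [hT0]
  have hDT1 : ((D ^ k * T : GL (Fin 2) K) : Matrix (Fin 2) (Fin 2) K) 1 0 =
      - ζ ^ (19 * k) * (ζ ^ 3 * c) := by
    rw [Units.val_mul, diag_pow_val hD, Matrix.mul_apply, Fin.sum_univ_two]
    simp [hT1]
  have key : ((D ^ k * T : GL (Fin 2) K) : Matrix (Fin 2) (Fin 2) K) 0 0 * B 1 0 =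
      ((D ^ k * T : GL (Fin 2) K) : Matrix (Fin 2) (Fin 2) K) 1 0 * B 0 0 := by
    rw [hDT0, hDT1, ← hku]
    ring
  interval_cases k
  · exact ⟨2, by simpa using key⟩
  · exact ⟨3, by simpa using key⟩
  · exact ⟨4, by simpa using key⟩
  · exact ⟨5, by simpa using key⟩

lemma rotation_mem_binaryStabilizer [CharZero K] {t c : K} (ht : t ^ 4 = -1)
    (hc : 2 * c ^ 2 = t ^ 2) {T : GL (Fin 2) K}
    (hT : (T : Matrix (Fin 2) (Fin 2) K) = !![-c, c * t ^ 5; -t * c, t * c * t]) :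
    T ∈ binaryStabilizer K := by
  refine mem_binaryStabilizer.2 fun y z => ?_
  have hc6 : c ^ 6 = t ^ 6 / 8 := by
    rw [show c ^ 6 = (2 * c ^ 2) ^ 3 / 8 by ring, hc]
    ring
  have h5 : t ^ 5 = -t := by linear_combination t * ht
  rw [hT, h5]
  simp only [Matrix.of_apply, Matrix.cons_val', Matrix.cons_val_zero, Matrix.cons_val_one,
    Matrix.cons_val_fin_one]
  linear_combination
    t * (y ^ 2 - t ^ 2 * z ^ 2) * ((y + t * z) ^ 4 + t ^ 4 * (y - t * z) ^ 4) * hc6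
    + (t ^ 7 * (y ^ 2 - t ^ 2 * z ^ 2) * (y - t * z) ^ 4 / 8 + y ^ 5 * z * (t ^ 4 - 1)
      - y * z ^ 5 * (t ^ 8 - t ^ 4 + 1)) * ht

set_option maxRecDepth 100000 in
lemma closure_eq_top_GL_two_ZMod_three {A B C : GL (Fin 2) (ZMod 3)}
    (hA : (A : Matrix (Fin 2) (Fin 2) (ZMod 3)) = !![1, -1; 1, 1])
    (hB : (B : Matrix (Fin 2) (Fin 2) (ZMod 3)) = !![1, 0; 0, -1])
    (hC : (C : Matrix (Fin 2) (Fin 2) (ZMod 3)) = !![0, -1; 1, -1]) :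
    Subgroup.closure {A, B, C} = ⊤ := by
  have key : ∀ a b c d : ZMod 3, a * d - b * c ≠ 0 → ∃ (i : Fin 8) (j : Fin 2) (k : Fin 3),
      !![a, b; c, d] = !![1, -1; 1, 1] ^ (i : ℕ) * !![1, 0; 0, -1] ^ (j : ℕ)
        * (!![0, -1; 1, -1] : Matrix (Fin 2) (Fin 2) (ZMod 3)) ^ (k : ℕ) := by
    decide +kernel
  rw [eq_top_iff]
  intro M _
  have : Fact (Nat.Prime 3) := ⟨Nat.prime_three⟩
  have hdet := Matrix.GeneralLinearGroup.det_ne_zero M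
  rw [Matrix.det_fin_two] at hdet
  obtain ⟨i, j, k, h⟩ := key _ _ _ _ hdet
  have hM : M = A ^ (i : ℕ) * B ^ (j : ℕ) * C ^ (k : ℕ) := by
    ext1
    rw [Units.val_mul, Units.val_mul, Units.val_pow_eq_pow_val, Units.val_pow_eq_pow_val,
      Units.val_pow_eq_pow_val, hA, hB, hC, ← h]
    exact Matrix.eta_fin_two _
  rw [hM]
  exact mul_mem (mul_mem (pow_mem (Subgroup.subset_closure (by simp)) _)
    (pow_mem (Subgroup.subset_closure (by simp)) _))
    (pow_mem (Subgroup.subset_closure (by simp)) _)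

/-- Generators of a lift of `GL₂(𝔽₃)` to `GL₂(ℤ[√-2])`, where `√-2` reduces to `-1`. -/
lemma exists_lift_GL_two_ZMod_three : ∃ A B C : GL (Fin 2) (ℤ√(-2)),
    (A : Matrix (Fin 2) (Fin 2) (ℤ√(-2))) = !![1, -1; -⟨0, 1⟩, ⟨0, 1⟩ - 1] ∧
    (B : Matrix (Fin 2) (Fin 2) (ℤ√(-2))) = !![1, -1 - ⟨0, 1⟩; 0, -1] ∧
    (C : Matrix (Fin 2) (Fin 2) (ℤ√(-2))) = !![0, -1; 1, -1] :=
  ⟨⟨_, !![1 - ⟨0, 1⟩, -1; -⟨0, 1⟩, -1], by decide, by decide⟩,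
    ⟨_, !![1, -1 - ⟨0, 1⟩; 0, -1], by decide, by decide⟩,
    ⟨_, !![-1, 1; -1, 0], by decide, by decide⟩, rfl, rfl, rfl⟩

lemma Zsqrtd.eq_one_of_pow_three_eq_one {r : ℤ√(-2)} (h : r ^ 3 = 1) : r = 1 := by
  have hn : r.norm ^ 3 = 1 := by
    have := map_pow (Zsqrtd.normMonoidHom (d := -2)) r 3
    rw [h, map_one] at this
    exact this.symm
  have hn1 : r.norm = 1 :=
    (pow_eq_one_iff_of_nonneg (Zsqrtd.norm_nonneg (by norm_num) r) (by norm_num)).1 hn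
  rw [Zsqrtd.norm_def] at hn1
  have him : r.im = 0 := by nlinarith [sq_nonneg r.re, sq_nonneg r.im]
  rw [him, mul_zero, sub_zero, mul_self_eq_one_iff] at hn1
  rcases hn1 with hre | hre
  · exact Zsqrtd.ext hre him
  · rw [(Zsqrtd.ext hre him : r = ⟨-1, 0⟩)] at h
    exact absurd h (by decide)

/-- A faithful action of `ℤ/3ℤ` by scalars. -/
lemma exists_hom_units_of_isPrimitiveRoot {ω : K} (hω : IsPrimitiveRoot ω 3) :
    ∃ θ : Multiplicative (ZMod 3) →* Kˣ, Function.Injective θ ∧ (∀ k, (θ k : K) ^ 3 = 1) ∧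
      ∃ k, (θ k : K) = ω := by
  have : Fact (Nat.Prime 3) := ⟨Nat.prime_three⟩
  obtain ⟨u, rfl⟩ := hω.isUnit (by norm_num)
  have hu : orderOf u = 3 := by rw [← orderOf_units, hω.eq_orderOf]
  let e : Multiplicative (ZMod 3) ≃* Subgroup.zpowers u :=
    mulEquivOfPrimeCardEq (p := 3) (by simp) (by rw [Nat.card_zpowers, hu])
  refine ⟨(Subgroup.zpowers u).subtype.comp e.toMonoidHom, ?_, fun k => ?_, ?_⟩
  · exact Subtype.val_injective.comp e.injective
  · have : k ^ 3 = 1 := by simpa using pow_card_eq_one' (x := k)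
    rw [← Units.val_pow_eq_pow_val, ← map_pow, this, map_one, Units.val_one]
  · exact ⟨e.symm ⟨u, Subgroup.mem_zpowers u⟩, by simp⟩

/-- Conjugating the lift of `GL₂(𝔽₃)` to `GL₂(ℤ[√-2])` into the stabilizer of the binary form. -/
lemma exists_conj_lift [CharZero K] {ζ : K} (hζ : IsPrimitiveRoot ζ 24)
    {D W T : GL (Fin 2) K} (hD : (D : Matrix (Fin 2) (Fin 2) K) = !![ζ, 0; 0, ζ ^ 19])
    (hW : (W : Matrix (Fin 2) (Fin 2) K) = !![0, 1; 1, 0])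
    (hT : (T : Matrix (Fin 2) (Fin 2) K) = !![-((1 + ζ ^ 6) / 2), ((1 + ζ ^ 6) / 2) * (ζ ^ 3) ^ 5;
      -(ζ ^ 3) * ((1 + ζ ^ 6) / 2), (ζ ^ 3) * ((1 + ζ ^ 6) / 2) * (ζ ^ 3)])
    {A B C : GL (Fin 2) (ℤ√(-2))}
    (hA : (A : Matrix (Fin 2) (Fin 2) (ℤ√(-2))) = !![1, -1; -⟨0, 1⟩, ⟨0, 1⟩ - 1])
    (hB : (B : Matrix (Fin 2) (Fin 2) (ℤ√(-2))) = !![1, -1 - ⟨0, 1⟩; 0, -1])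
    (hC : (C : Matrix (Fin 2) (Fin 2) (ℤ√(-2))) = !![0, -1; 1, -1])
    {ω : Kˣ} (hω : (ω : K) = ζ ^ 8) :
    ∃ (ι : ℤ√(-2) →+* K) (P : GL (Fin 2) K), Function.Injective ι ∧
      P * Matrix.GeneralLinearGroup.map ι A * P⁻¹ =
        Matrix.GeneralLinearGroup.scalar (Fin 2) ω * D ∧
      P * Matrix.GeneralLinearGroup.map ι B * P⁻¹ = W ∧
      P * Matrix.GeneralLinearGroup.map ι C * P⁻¹ = T := by
  have h12 : ζ ^ 12 = -1 :=
    (hζ.pow (by norm_num) (by norm_num : 24 = 12 * 2)).eq_neg_one_of_two_right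
  have hσ : (ζ ^ 3 + ζ ^ 9) * (ζ ^ 3 + ζ ^ 9) = ((-2 : ℤ) : K) := by
    push_cast
    linear_combination (ζ ^ 6 + 2) * h12
  let ι : ℤ√(-2) →+* K := Zsqrtd.lift ⟨_, hσ⟩
  have hι : ι ⟨0, 1⟩ = ζ ^ 3 + ζ ^ 9 := by simp [ι]
  obtain ⟨P, hP⟩ : ∃ P : GL (Fin 2) K, (P : Matrix (Fin 2) (Fin 2) K) =
      !![1, -((1 + ζ ^ 6) / 2 * (1 + ζ ^ 3)); 1, (1 + ζ ^ 6) / 2 * (ζ ^ 6 - ζ ^ 3)] := by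
    refine ⟨Matrix.GeneralLinearGroup.mkOfDetNeZero _ ?_, rfl⟩
    rw [Matrix.det_fin_two_of]
    have : 1 * ((1 + ζ ^ 6) / 2 * (ζ ^ 6 - ζ ^ 3)) - -((1 + ζ ^ 6) / 2 * (1 + ζ ^ 3)) * 1
        = ζ ^ 6 := by linear_combination h12 / 2
    rw [this]
    exact pow_ne_zero _ (hζ.ne_zero (by norm_num))
  refine ⟨ι, P, Zsqrtd.lift_injective _ fun n => by nlinarith [mul_self_nonneg n], ?_, ?_, ?_⟩ <;>
    rw [mul_inv_eq_iff_eq_mul]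
  · ext i j
    fin_cases i <;> fin_cases j <;>
      simp [Matrix.mul_apply, hP, hA, hD, hι, hω] <;> grind
  · ext i j
    fin_cases i <;> fin_cases j <;>
      simp [Matrix.mul_apply, hP, hB, hW, hι] <;> grind
  · ext i j
    fin_cases i <;> fin_cases j <;>
      simp [Matrix.mul_apply, hP, hC, hT] <;> grind

/-- A group generated by the scalar `ω ∈ μ₃` and a conjugate of a lift of `GL₂(𝔽₃)` to
`GL₂(ℤ[√-2])` is `Z/3Z × GL₂(𝔽₃)` as soon as its order is at most `144`. -/
lemma nonempty_mulEquiv_of_lift {G : Subgroup (GL (Fin 2) K)} [Finite G]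
    (hG : Nat.card G ≤ 144) {ω : K} (hω : IsPrimitiveRoot ω 3)
    {ι : ℤ√(-2) →+* K} (hι : Function.Injective ι) {P : GL (Fin 2) K}
    {A B C : GL (Fin 2) (ℤ√(-2))}
    (hA : (A : Matrix (Fin 2) (Fin 2) (ℤ√(-2))) = !![1, -1; -⟨0, 1⟩, ⟨0, 1⟩ - 1])
    (hB : (B : Matrix (Fin 2) (Fin 2) (ℤ√(-2))) = !![1, -1 - ⟨0, 1⟩; 0, -1])
    (hC : (C : Matrix (Fin 2) (Fin 2) (ℤ√(-2))) = !![0, -1; 1, -1])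
    (hGcl : ∀ u : Kˣ, (u : K) = ω → G = Subgroup.closure
      {Matrix.GeneralLinearGroup.scalar (Fin 2) u,
        P * Matrix.GeneralLinearGroup.map ι A * P⁻¹,
        P * Matrix.GeneralLinearGroup.map ι B * P⁻¹,
        P * Matrix.GeneralLinearGroup.map ι C * P⁻¹}) :
    Nonempty (G ≃* Multiplicative (ZMod 3) × GL (Fin 2) (ZMod 3)) := by
  have hρ : (-1 : ZMod 3) * (-1) = ((-2 : ℤ) : ZMod 3) := by decide
  have hsub : (-1 : ZMod 3) - 1 = 1 := by decide
  have : Fact (Nat.Prime 3) := ⟨Nat.prime_three⟩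
  obtain ⟨θ, hθ, hθ3, k₀, hk₀⟩ := exists_hom_units_of_isPrimitiveRoot hω
  let N : Subgroup (GL (Fin 2) (ℤ√(-2))) := Subgroup.closure {A, B, C}
  let conjι : GL (Fin 2) (ℤ√(-2)) →* GL (Fin 2) K :=
    (MulAut.conj P).toMonoidHom.comp (Matrix.GeneralLinearGroup.map ι)
  have hconj (n) : conjι n = P * Matrix.GeneralLinearGroup.map ι n * P⁻¹ := rfl
  let S : Kˣ →* GL (Fin 2) K := Matrix.GeneralLinearGroup.scalar (Fin 2)
  have hS (u : Kˣ) (M : GL (Fin 2) K) : Commute (S u) M := by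
    have : S u ∈ Subgroup.center (GL (Fin 2) K) := by
      rw [Matrix.GeneralLinearGroup.center_eq_range_scalar]
      exact ⟨u, rfl⟩
    exact (Subgroup.mem_center_iff.1 this M).symm
  let φ : Multiplicative (ZMod 3) × N →* GL (Fin 2) K :=
    (S.comp θ).noncommCoprod (conjι.comp N.subtype) fun k n => hS _ _
  have hφ (k n) : φ (k, n) = S (θ k) * conjι n := rfl
  have hcl := hGcl (θ k₀) hk₀
  have hrange : φ.range = G := by
    apply le_antisymm
    · rintro _ ⟨⟨k, n⟩, rfl⟩
      rw [hφ]
      refine mul_mem ?_ ?_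
      · obtain ⟨i, -, hi⟩ := hω.eq_pow_of_pow_eq_one (hθ3 k)
        rw [show θ k = θ k₀ ^ i from Units.ext (by rw [← hi, Units.val_pow_eq_pow_val, hk₀]),
          map_pow, hcl]
        exact pow_mem (Subgroup.subset_closure (by simp [S])) i
      · suffices N ≤ G.comap conjι from this n.2
        rw [Subgroup.closure_le, hcl]
        rintro _ (rfl | rfl | rfl) <;> exact Subgroup.subset_closure (by simp [hconj])
    · rw [hcl, Subgroup.closure_le]
      rintro _ (rfl | rfl | rfl | rfl)
      · exact ⟨(k₀, 1), by rw [hφ, Subgroup.coe_one, map_one, mul_one]⟩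
      · exact ⟨(1, ⟨A, Subgroup.subset_closure (by simp)⟩), by simp [hφ, hconj]⟩
      · exact ⟨(1, ⟨B, Subgroup.subset_closure (by simp)⟩), by simp [hφ, hconj]⟩
      · exact ⟨(1, ⟨C, Subgroup.subset_closure (by simp)⟩), by simp [hφ, hconj]⟩
  have hinj : Function.Injective φ := by
    rw [injective_iff_map_eq_one]
    rintro ⟨k, n⟩ hkn
    rw [hφ, hconj, ← mul_assoc, ← mul_assoc, (hS (θ k) P).eq, mul_assoc P, mul_inv_eq_one,
      mul_eq_left] at hkn
    have e (i j : Fin 2) : (S (θ k) * Matrix.GeneralLinearGroup.map ι (n : GL (Fin 2) (ℤ√(-2))) :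
      GL (Fin 2) K) i j = (1 : Matrix (Fin 2) (Fin 2) K) i j := by rw [hkn]; rfl
    have e' (i j : Fin 2) : (θ k : K) * ι ((n : GL (Fin 2) (ℤ√(-2))) i j) =
        (1 : Matrix (Fin 2) (Fin 2) K) i j := by
      rw [← e i j]
      fin_cases i <;> simp [S, Matrix.mul_apply]
    have h00 : (n : GL (Fin 2) (ℤ√(-2))) 0 0 = 1 := by
      apply Zsqrtd.eq_one_of_pow_three_eq_one
      apply hι
      have := congrArg (· ^ 3) (e' 0 0)
      simpa [mul_pow, hθ3] using this
    have hk : θ k = 1 := by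
      ext1
      simpa [h00] using e' 0 0
    have hn : (n : GL (Fin 2) (ℤ√(-2))) = 1 := by
      refine Units.ext (Matrix.ext fun i j => hι ?_)
      rw [← one_mul (ι _), ← Units.val_one, ← hk, e' i j]
      fin_cases i <;> fin_cases j <;> simp
    rw [Prod.mk_eq_one]
    exact ⟨hθ (by rw [hk, map_one]), Subtype.ext hn⟩
  let e : Multiplicative (ZMod 3) × N ≃* G :=
    (MonoidHom.ofInjective hinj).trans (MulEquiv.subgroupCongr hrange)
  have hfin : Finite N := Finite.of_injective (fun n => e (1, n)) fun a b h => by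
    simpa using h
  have hcard : Nat.card N ≤ 48 := by
    have := Nat.card_congr e.toEquiv
    rw [Nat.card_prod, Nat.card_eq_fintype_card (α := Multiplicative (ZMod 3)),
      Fintype.card_multiplicative, ZMod.card] at this
    lia
  let ρ : ℤ√(-2) →+* ZMod 3 := Zsqrtd.lift ⟨-1, hρ⟩
  have hρ1 : ρ ⟨0, 1⟩ = -1 := by simp [ρ]
  let red : N →* GL (Fin 2) (ZMod 3) := (Matrix.GeneralLinearGroup.map ρ).comp N.subtype
  have hred : Function.Surjective red := by
    rw [← MonoidHom.range_eq_top, MonoidHom.range_comp, Subgroup.range_subtype,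
      MonoidHom.map_closure]
    rw [Set.image_insert_eq, Set.image_insert_eq, Set.image_singleton]
    apply closure_eq_top_GL_two_ZMod_three
    · ext i j
      fin_cases i <;> fin_cases j <;> simp [hA, hρ1, hsub]
    · ext i j
      fin_cases i <;> fin_cases j <;> simp [hB, hρ1]
    · ext i j
      fin_cases i <;> fin_cases j <;> simp [hC]
  have hbij : Function.Bijective red :=
    hred.bijective_of_nat_card_le (by
      rw [Matrix.card_GL_field]
      simpa [Fin.prod_univ_succ] using hcard)
  exact ⟨e.symm.trans ((MulEquiv.refl _).prodCongr (MulEquiv.ofBijective red hbij))⟩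

/-- The stabilizer of the binary form is generated by three explicit matrices and has order
at most `144`. -/
lemma binaryStabilizer_eq_closure [CharZero K] {ζ : K} (hζ : IsPrimitiveRoot ζ 24)
    {D W T : GL (Fin 2) K} (hD : (D : Matrix (Fin 2) (Fin 2) K) = !![ζ, 0; 0, ζ ^ 19])
    (hW : (W : Matrix (Fin 2) (Fin 2) K) = !![0, 1; 1, 0])
    (hT : (T : Matrix (Fin 2) (Fin 2) K) = !![-((1 + ζ ^ 6) / 2), ((1 + ζ ^ 6) / 2) * (ζ ^ 3) ^ 5;
      -(ζ ^ 3) * ((1 + ζ ^ 6) / 2), (ζ ^ 3) * ((1 + ζ ^ 6) / 2) * (ζ ^ 3)]) :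
    binaryStabilizer K = Subgroup.closure {D, W, T} ∧
      Finite (binaryStabilizer K) ∧ Nat.card (binaryStabilizer K) ≤ 144 := by
  have h24 : ζ ^ 24 = 1 := hζ.pow_eq_one
  have h12 : ζ ^ 12 = -1 :=
    (hζ.pow (by norm_num) (by norm_num : 24 = 12 * 2)).eq_neg_one_of_two_right
  have hDs : D ∈ binaryStabilizer K := mem_binaryStabilizer.2 fun y z => by
    rw [hD]
    simp only [Matrix.of_apply, Matrix.cons_val', Matrix.cons_val_zero, Matrix.cons_val_one,
      Matrix.cons_val_fin_one]
    linear_combination (y ^ 5 * z + y * z ^ 5 * (ζ ^ 72 + ζ ^ 48 + ζ ^ 24 + 1)) * h24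
  have hWs : W ∈ binaryStabilizer K := mem_binaryStabilizer.2 fun y z => by
    rw [hW]
    simp only [Matrix.of_apply, Matrix.cons_val', Matrix.cons_val_zero, Matrix.cons_val_one,
      Matrix.cons_val_fin_one]
    ring
  have hTs : T ∈ binaryStabilizer K :=
    rotation_mem_binaryStabilizer (by rw [← pow_mul, h12])
      (by linear_combination (1 / 2 : K) * h12) hT
  have hcoset {B : GL (Fin 2) K} (hB : B ∈ binaryStabilizer K) :=
    exists_coset_of_mem_binaryStabilizer hζ hD hW (c := (1 + ζ ^ 6) / 2) (by simp [hT])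
      (by simp [hT]) hDs hWs hTs hB
  refine ⟨le_antisymm (fun B hB => ?_) ?_, ?_⟩
  · obtain ⟨i, k, rfl⟩ := hcoset hB
    have hDc : D ∈ Subgroup.closure {D, W, T} := Subgroup.subset_closure (by simp)
    have hWc : W ∈ Subgroup.closure {D, W, T} := Subgroup.subset_closure (by simp)
    have hTc : T ∈ Subgroup.closure {D, W, T} := Subgroup.subset_closure (by simp)
    refine mul_mem ?_ (pow_mem hDc k)
    fin_cases i <;> simp [one_mem, mul_mem, pow_mem, hDc, hWc, hTc]
  · rw [Subgroup.closure_le]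
    rintro _ (rfl | rfl | rfl) <;> assumption
  · have hinj : ∃ f : binaryStabilizer K → Fin 6 × Fin 24, Function.Injective f := by
      choose i k hik using fun B : binaryStabilizer K => hcoset B.2
      refine ⟨fun B => (i B, k B), fun A B h => Subtype.ext ?_⟩
      rw [Prod.mk.injEq] at h
      rw [hik A, hik B, h.1, h.2]
    obtain ⟨f, hf⟩ := hinj
    refine ⟨Finite.of_injective f hf, ?_⟩
    simpa using Nat.card_le_card_of_injective f hf

/-- The stabilizer of the binary form is `Z/3Z × GL₂(F₃)`. -/
lemma nonempty_binaryStabilizer_mulEquiv [CharZero K] {ζ : K} (hζ : IsPrimitiveRoot ζ 24)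
    {D W T : GL (Fin 2) K} (hD : (D : Matrix (Fin 2) (Fin 2) K) = !![ζ, 0; 0, ζ ^ 19])
    (hW : (W : Matrix (Fin 2) (Fin 2) K) = !![0, 1; 1, 0])
    (hT : (T : Matrix (Fin 2) (Fin 2) K) = !![-((1 + ζ ^ 6) / 2), ((1 + ζ ^ 6) / 2) * (ζ ^ 3) ^ 5;
      -(ζ ^ 3) * ((1 + ζ ^ 6) / 2), (ζ ^ 3) * ((1 + ζ ^ 6) / 2) * (ζ ^ 3)]) :
    Nonempty (binaryStabilizer K ≃* Multiplicative (ZMod 3) × GL (Fin 2) (ZMod 3)) := by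
  obtain ⟨hcl, hfin, hcard⟩ := binaryStabilizer_eq_closure hζ hD hW hT
  obtain ⟨A, B, C, hA, hB, hC⟩ := exists_lift_GL_two_ZMod_three
  have hω : IsPrimitiveRoot (ζ ^ 8) 3 := hζ.pow (by norm_num) (by norm_num)
  have hω0 : ζ ^ 8 ≠ 0 := hω.ne_zero (by norm_num)
  obtain ⟨ι, P, hι, hPA, hPB, hPC⟩ :=
    exists_conj_lift hζ hD hW hT hA hB hC (ω := Units.mk0 (ζ ^ 8) hω0) rfl
  refine nonempty_mulEquiv_of_lift (P := P) hcard hω hι hA hB hC fun u hu => ?_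
  obtain rfl : u = Units.mk0 (ζ ^ 8) hω0 := Units.ext hu
  rw [hPA, hPB, hPC]
  set s := Matrix.GeneralLinearGroup.scalar (Fin 2) (Units.mk0 (ζ ^ 8) hω0) with hs
  have hsD : s = D ^ 8 := by
    apply Units.ext
    rw [diag_pow_val hD]
    ext i j
    have : ζ ^ 152 = ζ ^ 8 := by
      rw [show 152 = 24 * 6 + 8 from rfl, pow_add, pow_mul, hζ.pow_eq_one, one_pow, one_mul]
    fin_cases i <;> fin_cases j <;> simp [hs, this]
  rw [hcl]
  apply le_antisymm
  · rw [Subgroup.closure_le]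
    rintro _ (h | rfl | rfl)
    · rw [h, SetLike.mem_coe, ← inv_mul_cancel_left s D]
      exact mul_mem (inv_mem (Subgroup.subset_closure (by simp)))
        (Subgroup.subset_closure (by simp))
    · exact Subgroup.subset_closure (by simp)
    · exact Subgroup.subset_closure (by simp)
  · have hDc : D ∈ Subgroup.closure {D, W, T} := Subgroup.subset_closure (by simp)
    rw [Subgroup.closure_le, hsD]
    rintro _ (rfl | rfl | rfl | rfl)
    · exact pow_mem hDc 8
    · exact mul_mem (pow_mem hDc 8) hDc
    · exact Subgroup.subset_closure (by simp)
    · exact Subgroup.subset_closure (by simp)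

/-- The sextic `X⁶ + Y⁵Z + YZ⁵` is smooth, its automorphism group has order `144`
and is isomorphic to `Z/3Z × GL₂(F₃)`; it is generated by `diag(1, ζ₂₄, ζ₂₄¹⁹)`, `[X:Z:Y]`,
and `[X : c(ζ₈⁵Z − Y) : ζ₈·c(ζ₈Z − Y)]` where `ζ₈ = ζ₂₄³`, `ζ₄ = ζ₂₄⁶` and `c = (1 + ζ₄)/2`. -/
theorem typeTwentyFour_sextic_automorphisms {K : Type*} [Field K] [IsAlgClosed K] [CharZero K]
    (ζ : K) (hζ : IsPrimitiveRoot ζ 24) :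
    IsSmoothSextic (X 0 ^ 6 + X 1 ^ 5 * X 2 + X 1 * X 2 ^ 5 : MvPolynomial (Fin 3) K) ∧
    Nat.card ↥(planeAut (X 0 ^ 6 + X 1 ^ 5 * X 2 + X 1 * X 2 ^ 5 : MvPolynomial (Fin 3) K))
      = 144 ∧
    Nonempty (↥(planeAut (X 0 ^ 6 + X 1 ^ 5 * X 2 + X 1 * X 2 ^ 5 : MvPolynomial (Fin 3) K))
      ≃* Multiplicative (ZMod 3) × (Matrix (Fin 2) (Fin 2) (ZMod 3))ˣ) ∧
    planeAut (X 0 ^ 6 + X 1 ^ 5 * X 2 + X 1 * X 2 ^ 5 : MvPolynomial (Fin 3) K)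
      = Subgroup.closure
        {pgl !![1, 0, 0; 0, ζ, 0; 0, 0, ζ ^ 19],
          pgl !![(1 : K), 0, 0; 0, 0, 1; 0, 1, 0],
          pgl !![1, 0, 0;
                 0, -((1 + ζ ^ 6) / 2), ((1 + ζ ^ 6) / 2) * (ζ ^ 3) ^ 5;
                 0, -(ζ ^ 3) * ((1 + ζ ^ 6) / 2), (ζ ^ 3) * ((1 + ζ ^ 6) / 2) * (ζ ^ 3)]} := by
  have h12 : ζ ^ 12 = -1 :=
    (hζ.pow (by norm_num) (by norm_num : 24 = 12 * 2)).eq_neg_one_of_two_right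
  have hζ0 : ζ ≠ 0 := hζ.ne_zero (by norm_num)
  obtain ⟨D, hD⟩ : ∃ D : GL (Fin 2) K,
      (D : Matrix (Fin 2) (Fin 2) K) = !![ζ, 0; 0, ζ ^ 19] :=
    ⟨Matrix.GeneralLinearGroup.mkOfDetNeZero _ (by simp [Matrix.det_fin_two, hζ0]), rfl⟩
  obtain ⟨W, hW⟩ : ∃ W : GL (Fin 2) K,
      (W : Matrix (Fin 2) (Fin 2) K) = !![0, 1; 1, 0] :=
    ⟨Matrix.GeneralLinearGroup.mkOfDetNeZero _ (by simp [Matrix.det_fin_two]), rfl⟩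
  obtain ⟨T, hT⟩ : ∃ T : GL (Fin 2) K, (T : Matrix (Fin 2) (Fin 2) K) =
      !![-((1 + ζ ^ 6) / 2), ((1 + ζ ^ 6) / 2) * (ζ ^ 3) ^ 5;
        -(ζ ^ 3) * ((1 + ζ ^ 6) / 2), (ζ ^ 3) * ((1 + ζ ^ 6) / 2) * (ζ ^ 3)] := by
    refine ⟨Matrix.GeneralLinearGroup.mkOfDetNeZero _ ?_, rfl⟩
    have : Matrix.det !![-((1 + ζ ^ 6) / 2), ((1 + ζ ^ 6) / 2) * (ζ ^ 3) ^ 5;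
        -(ζ ^ 3) * ((1 + ζ ^ 6) / 2), (ζ ^ 3) * ((1 + ζ ^ 6) / 2) * (ζ ^ 3)] = 1 := by
      rw [Matrix.det_fin_two_of]
      linear_combination (1 / 4 * (1 + ζ ^ 6) ^ 2 * ζ ^ 6 - ζ ^ 6 / 2 - 1) * h12
    rw [this]
    exact one_ne_zero
  obtain ⟨hcl, -, -⟩ := binaryStabilizer_eq_closure hζ hD hW hT
  obtain ⟨e⟩ := nonempty_binaryStabilizer_mulEquiv hζ hD hW hT
  have haut := planeAut_octahedralSextic (K := K)
  let e' : planeAut (octahedralSextic K) ≃* Multiplicative (ZMod 3) × GL (Fin 2) (ZMod 3) :=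
    (MulEquiv.subgroupCongr haut).trans
      (((binaryStabilizer K).equivMapOfInjective _ lowerBlockPGL_injective).symm.trans e)
  refine ⟨isSmoothSextic_octahedralSextic, ?_, ⟨e'⟩, ?_⟩
  · have : Fact (Nat.Prime 3) := ⟨Nat.prime_three⟩
    refine (Nat.card_congr e'.toEquiv).trans ?_
    rw [Nat.card_prod, Matrix.card_GL_field]
    simp [Fin.prod_univ_succ]
  · refine haut.trans ?_
    rw [hcl, MonoidHom.map_closure, Set.image_insert_eq, Set.image_insert_eq,
      Set.image_singleton, pgl_eq_lowerBlockPGL D (by simp [hD]),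
      pgl_eq_lowerBlockPGL W (by simp [hW]), pgl_eq_lowerBlockPGL T (by simp [hT])]
end
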